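/- arXiv:gr-qc/0308091 — 4 statements merged into one kernel-verified Lean document; each statement's English description precedes it below -/
import Mathlib

section
/- Let n ≥ 3 and let L : ℝⁿ → ℝⁿ be a bijective linear map such that η(L k, L k) = 0 for every null vector k (every null vector is mapped to a null vector). Then there exists a real number λ > 0 such that η(L u, L v) = λ · η(u,v) for all u, v ∈ ℝⁿ; that is, L is a conformal transformation of the Minkowski form. -/
open Finset

/-- The Minkowski (Lorentzian) bilinear form on `Fin n → ℝ`:
`η(u,v) = u 0 * v 0 - ∑_{i ≠ 0} u i * v i`. -/
def eta {n : ℕ} [NeZero n] (u v : Fin n → ℝ) : ℝ :=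
  u 0 * v 0 - ∑ i ∈ Finset.univ.filter (fun i => i ≠ 0), u i * v i

/-- A future-directed causal vector: nonzero, `η(u,u) ≥ 0`, `u 0 > 0`.  (The set Θ⁺.) -/
def FutureCausal {n : ℕ} [NeZero n] (u : Fin n → ℝ) : Prop :=
  u ≠ 0 ∧ 0 ≤ eta u u ∧ 0 < u 0

/-- A future-directed null vector: nonzero, `η(u,u) = 0`, `u 0 > 0`.  (The set ∂Θ⁺.) -/
def FutureNull {n : ℕ} [NeZero n] (u : Fin n → ℝ) : Prop :=
  u ≠ 0 ∧ eta u u = 0 ∧ 0 < u 0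

/-- A null vector: nonzero with `η(u,u) = 0`. -/
def IsNull {n : ℕ} [NeZero n] (u : Fin n → ℝ) : Prop :=
  u ≠ 0 ∧ eta u u = 0

/-- Bilinearity of `eta`, quadratic expansion. -/
theorem eta_comb {n : ℕ} [NeZero n] (a b : ℝ) (u v : Fin n → ℝ) :
    eta (a • u + b • v) (a • u + b • v)
      = a ^ 2 * eta u u + 2 * (a * b) * eta u v + b ^ 2 * eta v v := by
  unfold eta
  have : ∑ i ∈ Finset.univ.filter (fun i : Fin n => i ≠ 0),
      (a • u + b • v) i * (a • u + b • v) i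
      = a ^ 2 * ∑ i ∈ Finset.univ.filter (fun i : Fin n => i ≠ 0), u i * u i
      + 2 * (a * b) * ∑ i ∈ Finset.univ.filter (fun i : Fin n => i ≠ 0), u i * v i
      + b ^ 2 * ∑ i ∈ Finset.univ.filter (fun i : Fin n => i ≠ 0), v i * v i := by
    rw [Finset.mul_sum, Finset.mul_sum, Finset.mul_sum, ← Finset.sum_add_distrib,
      ← Finset.sum_add_distrib]
    refine Finset.sum_congr rfl fun i _ => ?_
    simp only [Pi.add_apply, Pi.smul_apply, smul_eq_mul]
    ring
  rw [this]
  simp only [Pi.add_apply, Pi.smul_apply, smul_eq_mul]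
  ring

theorem eta_self_nonpos {n : ℕ} [NeZero n] (u : Fin n → ℝ) (h : u 0 = 0) : eta u u ≤ 0 := by
  unfold eta
  have : 0 ≤ ∑ i ∈ Finset.univ.filter (fun i : Fin n => i ≠ 0), u i * u i :=
    Finset.sum_nonneg fun i _ => mul_self_nonneg _
  rw [h]
  linarith

theorem eta_self_zero {n : ℕ} [NeZero n] (u : Fin n → ℝ) (h : u 0 = 0) (h2 : eta u u = 0) :
    u = 0 := by
  unfold eta at h2
  have h3 : ∑ i ∈ Finset.univ.filter (fun i : Fin n => i ≠ 0), u i * u i = 0 := by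
    rw [h] at h2
    linarith
  rw [Finset.sum_eq_zero_iff_of_nonneg fun i _ => mul_self_nonneg _] at h3
  funext i
  by_cases hi : i = 0
  · rw [hi, h]; rfl
  · exact mul_self_eq_zero.mp (h3 i (by simp [hi]))

theorem eta_single_self {n : ℕ} [NeZero n] :
    eta (Pi.single 0 1 : Fin n → ℝ) (Pi.single 0 1) = 1 := by
  unfold eta
  rw [Finset.sum_eq_zero]
  · simp
  · intro i hi
    have : i ≠ 0 := by simpa using hi
    simp [this]

theorem eta_single_left {n : ℕ} [NeZero n] (x : Fin n → ℝ) (h : x 0 = 0) :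
    eta (Pi.single 0 1 : Fin n → ℝ) x = 0 := by
  unfold eta
  rw [Finset.sum_eq_zero]
  · simp [h]
  · intro i hi
    have : i ≠ 0 := by simpa using hi
    simp [this]

/-- A bijective linear map sending every null vector to a null vector is a conformal
transformation of the Minkowski form. -/
theorem stmt_3 {n : ℕ} [NeZero n] (hn : 3 ≤ n)
    (L : (Fin n → ℝ) →ₗ[ℝ] (Fin n → ℝ)) (hL : Function.Bijective L)
    (hnull : ∀ k, IsNull k → eta (L k) (L k) = 0) :
    ∃ lam : ℝ, 0 < lam ∧ ∀ u v, eta (L u) (L v) = lam * eta u v := by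
  classical
  set e : Fin n → ℝ := Pi.single 0 1 with he
  have he1 : eta e e = 1 := eta_single_self
  have he0 : e 0 = 1 := by simp [he]
  -- spatial vectors
  have key : ∀ x : Fin n → ℝ, x 0 = 0 →
      eta (L e) (L x) = 0 ∧ eta (L x) (L x) = eta (L e) (L e) * eta x x := by
    intro x hx
    by_cases hx0 : x = 0
    · subst hx0
      simp [eta]
    have hneg : eta x x ≤ 0 := eta_self_nonpos x hx
    have hne : eta x x ≠ 0 := fun h => hx0 (eta_self_zero x hx h)
    obtain ⟨s, hs, hs2⟩ : ∃ s : ℝ, 0 < s ∧ s ^ 2 = - eta x x := by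
      have : 0 < - eta x x := by
        have := lt_of_le_of_ne hneg hne
        linarith
      exact ⟨Real.sqrt (- eta x x), Real.sqrt_pos.mpr this, Real.sq_sqrt this.le⟩
    have hex : eta e x = 0 := eta_single_left x hx
    have hn1 : ∀ b : ℝ, b ^ 2 = 1 →
        s ^ 2 * eta (L e) (L e) + 2 * (s * b) * eta (L e) (L x)
          + b ^ 2 * eta (L x) (L x) = 0 := by
      intro b hb
      rw [← eta_comb, ← map_smul, ← map_smul, ← map_add]
      apply hnull
      refine ⟨fun h => ?_, ?_⟩
      · have h0 := congrFun h 0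
        simp [he0, hx] at h0
        exact hs.ne' h0
      · rw [eta_comb, he1, hex, hs2, hb]
        ring
    have h1 := hn1 1 (by norm_num)
    have h2 := hn1 (-1) (by norm_num)
    have h3 : s * eta (L e) (L x) = 0 := by linarith
    refine ⟨(mul_eq_zero.mp h3).resolve_left hs.ne', ?_⟩
    rw [hs2] at h1 h2
    linarith
  set lam := eta (L e) (L e) with hlam
  have quad : ∀ u, eta (L u) (L u) = lam * eta u u := by
    intro u
    have hx : (u - u 0 • e) 0 = 0 := by simp [he0]
    obtain ⟨h1, h2⟩ := key _ hx
    have hu : u = u 0 • e + (1 : ℝ) • (u - u 0 • e) := by simp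
    generalize u - u 0 • e = x at *
    generalize u 0 = a at *
    rw [hu, map_add, map_smul, map_smul, eta_comb, eta_comb, h1, h2, he1,
      eta_single_left x hx, ← hlam]
    ring
  refine ⟨lam, ?_, ?_⟩
  · by_contra hle
    have hle : lam ≤ 0 := not_lt.mp hle
    rcases hle.lt_or_eq with hlt | h0
    · let i1 : Fin n := ⟨1, by omega⟩
      let i2 : Fin n := ⟨2, by omega⟩
      have h10 : (0 : Fin n) ≠ i1 := by
        intro h; have := congrArg Fin.val h; simp [i1] at this
      have h20 : (0 : Fin n) ≠ i2 := by
        intro h; have := congrArg Fin.val h; simp [i2] at this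
      have h12 : i1 ≠ i2 := by
        intro h; have := congrArg Fin.val h; simp [i1, i2] at this
      let f1 : Fin n → ℝ := Pi.single i1 1
      let f2 : Fin n → ℝ := Pi.single i2 1
      have main : ∀ a b : ℝ, a * L f1 0 + b * L f2 0 = 0 → a = 0 ∧ b = 0 := by
        intro a b hab
        have hw0 : (a • f1 + b • f2) 0 = 0 := by
          simp [f1, f2, h10, h20]
        have hq := quad (a • f1 + b • f2)
        have hle1 : eta (L (a • f1 + b • f2)) (L (a • f1 + b • f2)) ≤ 0 := by
          apply eta_self_nonpos
          simpa using hab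
        have hle2 := eta_self_nonpos _ hw0
        have hz : eta (a • f1 + b • f2) (a • f1 + b • f2) = 0 := by
          nlinarith
        have hw := eta_self_zero _ hw0 hz
        constructor
        · simpa [f1, f2, h12] using congrFun hw i1
        · simpa [f1, f2, h12.symm] using congrFun hw i2
      obtain ⟨h1, h2⟩ := main (L f2 0) (-(L f1 0)) (by ring)
      have h3 := main 1 1 (by rw [h1, neg_eq_zero.mp h2]; ring)
      exact one_ne_zero h3.1
    · obtain ⟨u, hu⟩ := hL.2 e
      have := quad u
      rw [hu, he1, h0] at this
      simp at this
  · intro u v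
    have h := quad ((1 : ℝ) • u + (1 : ℝ) • v)
    rw [map_add, map_smul, map_smul, eta_comb, eta_comb, quad u, quad v] at h
    linarith
end

section
/- Let n ≥ 2 and let L : ℝⁿ → ℝⁿ be a bijective linear map with L u ∈ Θ⁺ for every u ∈ Θ⁺, and let B be the pullback bilinear form B(u,v) = η(L u, L v). Then for every k ∈ ∂Θ⁺ one has η(B♯ k, B♯ k) = 0 if and only if B(k,k) = 0; that is, the set of null directions of B coincides with its set of principal directions: σ(B) = μ(B). -/
open Finset

lemma eta_e0 {n : ℕ} [NeZero n] (u : Fin n → ℝ) : eta u (Pi.single 0 1) = u 0 := by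
  unfold eta
  rw [Finset.sum_eq_zero]
  · simp
  · intro i hi
    have : i ≠ 0 := (Finset.mem_filter.mp hi).2
    simp [this]

lemma fc_e0 {n : ℕ} [NeZero n] : FutureCausal (Pi.single 0 1 : Fin n → ℝ) := by
  refine ⟨?_, ?_, ?_⟩
  · intro h
    have := congrFun h 0
    simp at this
  · rw [eta_e0]; simp
  · simp

lemma eta_nonneg {n : ℕ} [NeZero n] {u v : Fin n → ℝ} (hu : FutureCausal u)
    (hv : FutureCausal v) : 0 ≤ eta u v := by
  obtain ⟨-, hu1, hu0⟩ := hu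
  obtain ⟨-, hv1, hv0⟩ := hv
  unfold eta at *
  have cs := Finset.sum_mul_sq_le_sq_mul_sq (Finset.univ.filter (fun i : Fin n => i ≠ 0)) u v
  simp only [sq (u _), sq (v _)] at cs
  have hb : 0 ≤ ∑ i ∈ Finset.univ.filter (fun i : Fin n => i ≠ 0), v i * v i :=
    Finset.sum_nonneg fun i _ => mul_self_nonneg _
  have h := mul_le_mul (sub_nonneg.mp hu1) (sub_nonneg.mp hv1) hb (mul_self_nonneg _)
  have h2 := cs.trans h
  rw [mul_mul_mul_comm, ← sq] at h2
  exact sub_nonneg.mpr (le_of_abs_le (abs_le_of_sq_le_sq h2 (by positivity)))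

lemma eta_zero {n : ℕ} [NeZero n] {u v : Fin n → ℝ} (hu : FutureCausal u)
    (hv : FutureCausal v) (h0 : eta u v = 0) : eta u u = 0 := by
  obtain ⟨-, hu1, hu0⟩ := hu
  obtain ⟨-, hv1, hv0⟩ := hv
  unfold eta at *
  have cs := Finset.sum_mul_sq_le_sq_mul_sq (Finset.univ.filter (fun i : Fin n => i ≠ 0)) u v
  simp only [sq (u _), sq (v _)] at cs
  have ha : 0 ≤ ∑ i ∈ Finset.univ.filter (fun i : Fin n => i ≠ 0), u i * u i :=
    Finset.sum_nonneg fun i _ => mul_self_nonneg _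
  have h := mul_le_mul_of_nonneg_left (sub_nonneg.mp hv1) ha
  rw [← sub_eq_zero.mp h0] at cs
  have h2 := cs.trans h
  have h3 : u 0 * u 0 ≤ ∑ i ∈ Finset.univ.filter (fun i : Fin n => i ≠ 0), u i * u i := by
    refine le_of_mul_le_mul_right ?_ (mul_pos hv0 hv0)
    linarith [h2, sq (u 0 * v 0), mul_mul_mul_comm (u 0) (v 0) (u 0) (v 0)]
  linarith

lemma fc_of_dual {n : ℕ} [NeZero n] {w : Fin n → ℝ} (hw : w ≠ 0)
    (h : ∀ v, FutureCausal v → 0 ≤ eta w v) : FutureCausal w := by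
  have h0 : 0 ≤ w 0 := by simpa [eta_e0] using h _ fc_e0
  set S := ∑ i ∈ Finset.univ.filter (fun i : Fin n => i ≠ 0), w i * w i with hS
  have hS0 : 0 ≤ S := Finset.sum_nonneg fun i _ => mul_self_nonneg _
  have key : S ≤ w 0 * w 0 := by
    rcases hS0.eq_or_lt with e | hpos
    · rw [← e]; positivity
    have hr : 0 < √S := Real.sqrt_pos.mpr hpos
    have hrs : √S * √S = S := Real.mul_self_sqrt hS0
    have e1 : ∀ x : Fin n → ℝ, eta x (Function.update w 0 (√S)) =
        x 0 * √S - ∑ i ∈ Finset.univ.filter (fun i : Fin n => i ≠ 0), x i * w i := by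
      intro x
      unfold eta
      rw [Function.update_self]
      congr 1
      refine Finset.sum_congr rfl fun i hi => ?_
      rw [Function.update_of_ne (Finset.mem_filter.mp hi).2]
    have hv : FutureCausal (Function.update w 0 (√S)) := by
      refine ⟨fun hz => ?_, ?_, by simpa using hr⟩
      · have := congrFun hz 0
        simp at this
        linarith [this]
      · rw [e1, Function.update_self, hrs]
        rw [Finset.sum_congr rfl (g := fun i => w i * w i), ← hS, sub_self]
        intro i hi
        rw [Function.update_of_ne (Finset.mem_filter.mp hi).2]
    have h2 := h _ hv
    rw [e1, ← hS] at h2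
    have h3 : √S ≤ w 0 := by
      refine le_of_mul_le_mul_right ?_ hr
      linarith
    calc S = √S * √S := hrs.symm
      _ ≤ _ := mul_self_le_mul_self hr.le h3
  refine ⟨hw, sub_nonneg.mpr key, lt_of_le_of_ne h0 fun e => hw ?_⟩
  have hz : S = 0 := by
    rw [← e] at key
    linarith
  rw [hS, Finset.sum_eq_zero_iff_of_nonneg fun i _ => mul_self_nonneg _] at hz
  funext i
  by_cases hi : i = 0
  · rw [hi, ← e]; rfl
  · exact mul_self_eq_zero.mp (hz i (by simp [hi]))

/-- For the pullback `B(u,v) = η(Lu, Lv)` of the metric under a causal symmetry `L`,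
the set of null directions of `B` coincides with its set of principal directions:
for every future-directed null `k`, `η(B♯k, B♯k) = 0 ↔ B(k,k) = 0`. -/
theorem stmt_5 {n : ℕ} [NeZero n] (hn : 2 ≤ n)
    (L : (Fin n → ℝ) →ₗ[ℝ] (Fin n → ℝ)) (hL : Function.Bijective L)
    (hcaus : ∀ u, FutureCausal u → FutureCausal (L u))
    (Bsharp : (Fin n → ℝ) →ₗ[ℝ] (Fin n → ℝ))
    (hBsharp : ∀ u v, eta (Bsharp u) v = eta (L u) (L v)) :
    ∀ k, FutureNull k →
      (eta (Bsharp k) (Bsharp k) = 0 ↔ eta (L k) (L k) = 0) := by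
  intro k hk
  have hkc : FutureCausal k := ⟨hk.1, hk.2.1.ge, hk.2.2⟩
  have hLk := hcaus k hkc
  have hw : FutureCausal (Bsharp k) := by
    refine fc_of_dual ?_ fun v hv => ?_
    · intro hz
      obtain ⟨x, hx⟩ := hL.2 (Pi.single 0 1)
      have h1 := hBsharp k x
      rw [hz, hx, eta_e0] at h1
      have h2 : eta (0 : Fin n → ℝ) x = 0 := by simp [eta]
      linarith [hLk.2.2]
    · rw [hBsharp]
      exact eta_nonneg hLk (hcaus v hv)
  constructor
  · intro h
    rw [hBsharp] at h
    exact eta_zero hLk (hcaus _ hw) h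
  · intro h
    rw [← hBsharp] at h
    exact eta_zero hw hkc h
end

section
/- Let n ≥ 2 and let B be a symmetric future tensor (bilinear form) on ℝⁿ. For every k ∈ ∂Θ⁺ one has B(k,k) = 0 if and only if there exists a real λ ≥ 0 such that B(k,v) = λ · η(k,v) for all v ∈ ℝⁿ; that is, the principal directions of B are exactly its null eigenvectors. -/
open Finset

lemma eta_add_smul {n : ℕ} [NeZero n] (k u v : Fin n → ℝ) (t : ℝ) :
    eta k (u + t • v) = eta k u + t * eta k v := by
  simp only [eta, Pi.add_apply, Pi.smul_apply, smul_eq_mul, mul_add, Finset.sum_add_distrib,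
    mul_sub, Finset.mul_sum]
  have : ∑ i ∈ Finset.univ.filter (fun i : Fin n => i ≠ 0), k i * (t * v i)
      = ∑ i ∈ Finset.univ.filter (fun i : Fin n => i ≠ 0), t * (k i * v i) :=
    Finset.sum_congr rfl (fun i _ => by ring)
  rw [this]; ring

lemma eta_comm {n : ℕ} [NeZero n] (u v : Fin n → ℝ) : eta u v = eta v u := by
  simp only [eta, mul_comm]

lemma eta_single {n : ℕ} [NeZero n] (k : Fin n → ℝ) :
    eta k (Pi.single 0 1) = k 0 := by
  have : ∑ i ∈ Finset.univ.filter (fun i : Fin n => i ≠ 0),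
      k i * (Pi.single 0 1 : Fin n → ℝ) i = 0 := by
    refine Finset.sum_eq_zero (fun i hi => ?_)
    have hi' : i ≠ 0 := (Finset.mem_filter.mp hi).2
    simp [Pi.single_eq_of_ne hi']
  simp [eta, this]

/-- A linear form nonnegative on the future cone and vanishing at a null `k` is nonnegative on
the half space `η(k,v) > 0`. -/
lemma half_space {n : ℕ} [NeZero n] (f : (Fin n → ℝ) →ₗ[ℝ] ℝ)
    (hf : ∀ v, FutureCausal v → 0 ≤ f v) (k : Fin n → ℝ) (hk : FutureNull k) (h0 : f k = 0)
    (v : Fin n → ℝ) (hv : 0 < eta k v) : 0 ≤ f v := by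
  obtain ⟨_, hkk, hk0⟩ := hk
  set a := |eta v v| / (2 * eta k v) with ha
  set b := (|v 0| + 1) / k 0 with hb
  have ha0 : 0 ≤ a := by positivity
  have hb0 : 0 ≤ b := by positivity
  have ha1 : a * (2 * eta k v) = |eta v v| := by rw [ha]; field_simp
  have hb1 : b * k 0 = |v 0| + 1 := by rw [hb]; field_simp
  have hpos : 0 < (v + (a + b) • k) 0 := by
    simp only [Pi.add_apply, Pi.smul_apply, smul_eq_mul]
    nlinarith [neg_abs_le (v 0), mul_nonneg ha0 hk0.le]
  have h := hf (v + (a + b) • k) ⟨fun h => by rw [h] at hpos; simp at hpos, ?_, hpos⟩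
  · simpa [h0] using h
  · rw [eta_add_smul, eta_comm _ v, eta_add_smul, eta_comm (v + (a + b) • k) k, eta_add_smul, hkk,
      eta_comm v k]
    nlinarith [neg_abs_le (eta v v), mul_nonneg hb0 hv.le]

/-- The principal directions of a symmetric future tensor are exactly its null
eigenvectors. -/
theorem stmt_9 {n : ℕ} [NeZero n] (hn : 2 ≤ n)
    (B : (Fin n → ℝ) →ₗ[ℝ] (Fin n → ℝ) →ₗ[ℝ] ℝ)
    (hsym : ∀ u v, B u v = B v u)
    (hfut : ∀ u v, FutureCausal u → FutureCausal v → 0 ≤ B u v) :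
    ∀ k, FutureNull k →
      (B k k = 0 ↔ ∃ lam : ℝ, 0 ≤ lam ∧ ∀ v, B k v = lam * eta k v) := by
  intro k hk
  have hk0 := hk.2.2
  constructor
  · intro h0
    have hkc : FutureCausal k := ⟨hk.1, hk.2.1.ge, hk0⟩
    have key := half_space (B k) (fun v hv => hfut k v hkc hv) k hk h0
    set e : Fin n → ℝ := Pi.single 0 1 with he
    have hke : eta k e = k 0 := eta_single k
    have hfe : 0 ≤ B k e := key e (by rw [hke]; exact hk0)
    have ker : ∀ w, eta k w = 0 → 0 ≤ B k w := by
      intro w hw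
      refine le_of_forall_pos_le_add (fun ε hε => ?_)
      have hd : 0 < ε / (B k e + 1) := by positivity
      have h1 := key (w + (ε / (B k e + 1)) • e) (by
        rw [eta_add_smul, hw, hke]; positivity)
      simp only [map_add, map_smul, smul_eq_mul] at h1
      have h2 : ε / (B k e + 1) * (B k e + 1) = ε := by field_simp
      nlinarith
    refine ⟨B k e / k 0, by positivity, fun v => ?_⟩
    have hw : eta k (v + (-(eta k v / k 0)) • e) = 0 := by
      rw [eta_add_smul, hke]; field_simp; ring
    have hw' : eta k (0 + (-1 : ℝ) • (v + (-(eta k v / k 0)) • e)) = 0 := by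
      rw [eta_add_smul, hw]; simp [eta]
    have h1 := ker _ hw
    have h2 := ker _ hw'
    simp only [map_add, map_smul, smul_eq_mul, map_zero] at h1 h2
    have h3 : B k e / k 0 * eta k v = eta k v / k 0 * B k e := by ring
    rw [h3]; linarith
  · rintro ⟨lam, _, h⟩
    rw [h k, hk.2.1, mul_zero]
end

section
/- Let n ≥ 2 and let B be a symmetric future tensor (bilinear form) on ℝⁿ of Lorentzian signature, in the sense that there exists a bijective linear map e : ℝⁿ → ℝⁿ with B(e u, e v) = η(u,v) for all u,v. Then for every k ∈ ∂Θ⁺ one has B(k,k) = 0 if and only if η(B♯k, B♯k) = 0; that is, σ(B) = μ(B). -/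
open Finset

lemma eq_zero_of_spatial {n : ℕ} [NeZero n] (y : Fin n → ℝ) (h0 : y 0 = 0)
    (hs : ∑ i ∈ Finset.univ.filter (fun i : Fin n => i ≠ 0), y i * y i ≤ 0) : y = 0 := by
  have hn : ∀ i ∈ Finset.univ.filter (fun i : Fin n => i ≠ 0), 0 ≤ y i * y i :=
    fun i _ => mul_self_nonneg _
  have hz := (Finset.sum_eq_zero_iff_of_nonneg hn).1 (le_antisymm hs (Finset.sum_nonneg hn))
  funext i
  by_cases hi : i = 0
  · rw [hi, h0]; rfl
  · exact mul_self_eq_zero.1 (hz i (by simp [hi]))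

lemma eta_neg_of_orth {n : ℕ} [NeZero n] (x y : Fin n → ℝ) (hx : 0 < eta x x)
    (hxy : eta x y = 0) (hy : y ≠ 0) : eta y y < 0 := by
  by_contra hc
  apply hy
  have cs := Finset.sum_mul_sq_le_sq_mul_sq (Finset.univ.filter (fun i : Fin n => i ≠ 0)) x y
  simp only [pow_two (x _), pow_two (y _)] at cs
  have hX : 0 ≤ ∑ i ∈ Finset.univ.filter (fun i : Fin n => i ≠ 0), x i * x i :=
    Finset.sum_nonneg fun i _ => mul_self_nonneg _
  unfold eta at *
  push Not at hc
  have hp : ∑ i ∈ Finset.univ.filter (fun i : Fin n => i ≠ 0), x i * y i = x 0 * y 0 := by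
    linarith
  rw [hp] at cs
  generalize hXe : ∑ i ∈ Finset.univ.filter (fun i : Fin n => i ≠ 0), x i * x i = X at *
  have h0 : y 0 = 0 := by
    have h1 := mul_le_mul_of_nonneg_left (sub_nonneg.1 hc) hX
    have h2 : (x 0 * x 0 - X) * (y 0 * y 0) ≤ 0 := by nlinarith
    have h3 : y 0 * y 0 ≤ 0 := by
      by_contra h
      push Not at h
      exact absurd (mul_pos hx h) (not_lt.2 h2)
    exact mul_self_eq_zero.1 (le_antisymm h3 (mul_self_nonneg _))
  refine eq_zero_of_spatial y h0 ?_
  rw [h0] at hc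
  linarith

/-- A vector whose pairing with all future causal vectors is nonnegative is causal. -/
lemma dual_cone {n : ℕ} [NeZero n] (l : Fin n → ℝ)
    (h : ∀ v, FutureCausal v → 0 ≤ eta l v) : 0 ≤ l 0 ∧ 0 ≤ eta l l := by
  have key : ∀ (a b : ℝ), 0 < a →
      b * b * (∑ i ∈ Finset.univ.filter (fun i : Fin n => i ≠ 0), l i * l i) ≤ a * a →
      0 ≤ l 0 * a - b * ∑ i ∈ Finset.univ.filter (fun i : Fin n => i ≠ 0), l i * l i := by
    intro a b ha hab
    let v : Fin n → ℝ := fun i => if i = 0 then a else b * l i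
    have v0 : v 0 = a := by simp [v]
    have h1 : eta v v = a * a -
        b * b * (∑ i ∈ Finset.univ.filter (fun i : Fin n => i ≠ 0), l i * l i) := by
      unfold eta
      rw [v0, Finset.mul_sum]
      congr 1
      refine Finset.sum_congr rfl fun i hi => ?_
      have : i ≠ 0 := by simpa using hi
      simp only [v, if_neg this]; ring
    have h2 : eta l v = l 0 * a -
        b * (∑ i ∈ Finset.univ.filter (fun i : Fin n => i ≠ 0), l i * l i) := by
      unfold eta
      rw [v0, Finset.mul_sum]
      congr 1
      refine Finset.sum_congr rfl fun i hi => ?_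
      have : i ≠ 0 := by simpa using hi
      simp only [v, if_neg this]; ring
    rw [← h2]
    refine h v ⟨?_, by rw [h1]; linarith, by rw [v0]; exact ha⟩
    intro hv
    rw [hv] at v0
    simp at v0
    linarith
  have hS : 0 ≤ ∑ i ∈ Finset.univ.filter (fun i : Fin n => i ≠ 0), l i * l i :=
    Finset.sum_nonneg fun i _ => mul_self_nonneg _
  unfold eta
  generalize ∑ i ∈ Finset.univ.filter (fun i : Fin n => i ≠ 0), l i * l i = S at *
  have h0 : 0 ≤ l 0 := by simpa using key 1 0 one_pos (by simp)
  refine ⟨h0, ?_⟩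
  rcases hS.eq_or_lt with hS | hS
  · rw [← hS]; simpa using mul_self_nonneg (l 0)
  · have hr := Real.sqrt_pos.2 hS
    have hrr := Real.mul_self_sqrt hS.le
    have := key (√S) 1 hr (by rw [hrr]; simp)
    have h3 : √S ≤ l 0 := by
      by_contra hc
      push Not at hc
      nlinarith
    nlinarith

/-- For a symmetric future tensor of Lorentzian signature, the set of null
directions equals the set of principal directions: `σ(B) = μ(B)`. -/
theorem stmt_11 {n : ℕ} [NeZero n] (hn : 2 ≤ n)
    (B : (Fin n → ℝ) →ₗ[ℝ] (Fin n → ℝ) →ₗ[ℝ] ℝ)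
    (hsym : ∀ u v, B u v = B v u)
    (hfut : ∀ u v, FutureCausal u → FutureCausal v → 0 ≤ B u v)
    (e : (Fin n → ℝ) →ₗ[ℝ] (Fin n → ℝ)) (he : Function.Bijective e)
    (hLor : ∀ u v, B (e u) (e v) = eta u v)
    (Bsharp : (Fin n → ℝ) →ₗ[ℝ] (Fin n → ℝ))
    (hBsharp : ∀ u v, eta (Bsharp u) v = B u v) :
    ∀ k, FutureNull k → (B k k = 0 ↔ eta (Bsharp k) (Bsharp k) = 0) := by
  intro k hk
  have hkc : FutureCausal k := ⟨hk.1, hk.2.1.ge, hk.2.2⟩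
  obtain ⟨hl0, hll⟩ := dual_cone (Bsharp k) fun v hv => by
    rw [hBsharp]; exact hfut k v hkc hv
  constructor
  · intro hB
    by_contra hne
    have := eta_neg_of_orth (Bsharp k) k (lt_of_le_of_ne hll (Ne.symm hne))
      (by rw [hBsharp, hB]) hk.1
    exact absurd hk.2.1 this.ne
  · intro hnull
    by_contra hne
    have hpos : 0 < B k k := lt_of_le_of_ne (hfut k k hkc hkc) (Ne.symm hne)
    have hlne : Bsharp k ≠ 0 := by
      intro h
      apply hne
      rw [← hBsharp, h]
      simp [eta]
    have hl0' : 0 < Bsharp k 0 := by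
      refine lt_of_le_of_ne hl0 fun h => hlne (eq_zero_of_spatial _ h.symm ?_)
      unfold eta at hnull
      rw [← h] at hnull
      linarith
    have hlc : FutureCausal (Bsharp k) := ⟨hlne, hll, hl0'⟩
    obtain ⟨x, hx⟩ := he.2 k
    obtain ⟨y, hy⟩ := he.2 (Bsharp k)
    have hneg := eta_neg_of_orth x y (by rw [← hLor, hx]; exact hpos)
      (by rw [← hLor, hx, hy, ← hBsharp]; exact hnull)
      (by rintro rfl; apply hlne; rw [← hy, map_zero])
    rw [← hLor, hy] at hneg
    exact absurd (hfut _ _ hlc hlc) (not_le.2 hneg)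
end
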